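/- The element α = 1² + 1² + 1² + (2+√7)² + ((√7+√11)/2)² + (1+(√7+√11)/2)² in the ring of integers of Q(√7, √11) cannot be expressed as a sum of 5 or fewer squares of algebraic integers of the field; that is, ℓ(α) = 6. -/

import Mathlib

open scoped Classical

noncomputable section

/-- `α` is a sum of `n` squares of elements of `S ⊆ ℝ`. -/
def SumOfSquaresLen (S : Set ℝ) (n : ℕ) (α : ℝ) : Prop :=
  ∃ x : Fin n → ℝ, (∀ i, x i ∈ S) ∧ α = ∑ i, x i ^ 2

/-- The length of `α` as a sum of squares of elements of `S` (∞ if not a sum of squares). -/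
def sqLength (S : Set ℝ) (α : ℝ) : ℕ∞ :=
  sInf {n : ℕ∞ | ∃ k : ℕ, n = (k : ℕ∞) ∧ SumOfSquaresLen S k α}

/-- The Pythagoras number of `S ⊆ ℝ`. -/
def pythagorasNumber (S : Set ℝ) : ℕ∞ :=
  sSup {n : ℕ∞ | ∃ α : ℝ, (∃ k : ℕ, SumOfSquaresLen S k α) ∧ n = sqLength S α}

/-- The biquadratic field `ℚ(√p, √q)` as a subfield of `ℝ`. -/
def biquadField (p q : ℝ) : IntermediateField ℚ ℝ :=
  IntermediateField.adjoin ℚ {Real.sqrt p, Real.sqrt q}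

/-- The ring of integers of `ℚ(√p, √q)`, viewed as a subset of `ℝ`. -/
def ringOfInt (p q : ℝ) : Set ℝ :=
  {x : ℝ | x ∈ biquadField p q ∧ IsIntegral ℤ x}

theorem mem_len_succ {S : Set ℝ} (h0 : (0:ℝ) ∈ S) {k : ℕ} {α : ℝ}
    (h : SumOfSquaresLen S k α) : SumOfSquaresLen S (k+1) α := by
  obtain ⟨x, hx, e⟩ := h
  refine ⟨Fin.cons 0 x, ?_, ?_⟩
  · intro i
    refine Fin.cases ?_ (fun i => ?_) i
    · simpa using h0
    · simpa using hx i
  · rw [Fin.sum_univ_succ]; simpa using e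

theorem int_of_integral (q : ℚ) (h : IsIntegral ℤ (q : ℝ)) : ∃ n : ℤ, q = n := by
  have h' : IsIntegral ℤ (algebraMap ℚ ℝ q) := by simpa using h
  rw [isIntegral_algebraMap_iff (algebraMap ℚ ℝ).injective] at h'
  obtain ⟨n, hn⟩ := IsIntegrallyClosed.isIntegral_iff.1 h'
  exact ⟨n, by simpa using hn.symm⟩

theorem quad (m : ℤ) (hm : Squarefree m) (u : ℝ) (hu : u ^ 2 = m) (t w : ℚ)
    (h1 : IsIntegral ℤ ((t : ℝ) + w * u)) (h2 : IsIntegral ℤ ((t : ℝ) - w * u)) :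
    ∃ T W : ℤ, 2 * t = T ∧ 2 * w = W ∧ 4 ∣ T ^ 2 - m * W ^ 2 := by
  obtain ⟨T, hT⟩ := int_of_integral (2 * t) (by
    have := h1.add h2
    have e : ((2 * t : ℚ) : ℝ) = t + w * u + (t - w * u) := by push_cast; ring
    rwa [e])
  obtain ⟨N, hN⟩ := int_of_integral (t ^ 2 - m * w ^ 2) (by
    have := h1.mul h2
    have e : ((t ^ 2 - m * w ^ 2 : ℚ) : ℝ) = (t + w * u) * (t - w * u) := by
      push_cast; rw [← hu]; ring
    rwa [e])
  have hm0 : m ≠ 0 := hm.ne_zero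
  have hmq : (m : ℚ) ≠ 0 := by exact_mod_cast hm0
  have key : (m * (2 * w)) ^ 2 = ((m * (T ^ 2 - 4 * N) : ℤ) : ℚ) := by
    push_cast; rw [← hT, ← hN]; ring
  have hi : IsIntegral ℤ (m * (2 * w) : ℚ) := by
    apply IsIntegral.of_pow (n := 2) (by norm_num)
    rw [key]; exact isIntegral_algebraMap (R := ℤ) (A := ℚ)
  obtain ⟨n, hn⟩ := IsIntegrallyClosed.isIntegral_iff.1 hi
  have hn : (n : ℚ) = m * (2 * w) := by simpa using hn
  rw [← hn] at key
  have key : n ^ 2 = m * (T ^ 2 - 4 * N) := by exact_mod_cast key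
  have hd : m ∣ n := hm.isRadical 2 n ⟨_, key⟩
  obtain ⟨W, rfl⟩ := hd
  have hW : 2 * w = W := by
    push_cast at hn
    exact (mul_left_cancel₀ hmq hn).symm
  refine ⟨T, W, hT, hW, N, ?_⟩
  have : ((T ^ 2 - m * W ^ 2 : ℤ) : ℚ) = ((4 * N : ℤ) : ℚ) := by
    push_cast; rw [← hT, ← hW, ← hN]; ring
  exact_mod_cast this

theorem indep2 {u : ℝ} (hu : Irrational u) (A B : ℚ) (h : (A : ℝ) + B * u = 0) :
    A = 0 ∧ B = 0 := by
  have hB : B = 0 := by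
    by_contra hB
    apply hu
    refine ⟨-A / B, ?_⟩
    have : (B : ℝ) ≠ 0 := by exact_mod_cast hB
    push_cast
    field_simp
    linarith
  subst hB
  simpa using h

theorem irr7 : Irrational (√7) := by
  simpa using (show Nat.Prime 7 by norm_num).irrational_sqrt
theorem irr11 : Irrational (√11) := by
  simpa using (show Nat.Prime 11 by norm_num).irrational_sqrt

theorem sq77 (A B : ℚ) (h : A ^ 2 = 77 * B ^ 2) : A = 0 ∧ B = 0 := by
  have irr : Irrational (√77) := by
    have : Irrational (√((77:ℕ):ℝ)) := by
      rw [irrational_sqrt_natCast_iff]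
      rintro ⟨r, hr⟩
      have : r < 9 := by nlinarith
      interval_cases r <;> omega
    simpa using this
  have h77 : √77 ^ 2 = (77:ℝ) := Real.sq_sqrt (by norm_num)
  have h' : (A:ℝ) ^ 2 = 77 * B ^ 2 := by exact_mod_cast h
  have : ((A:ℝ) + B * √77) * (A + (-B) * √77) = 0 := by
    linear_combination h' - B ^ 2 * h77
  rcases mul_eq_zero.1 this with h | h
  · exact indep2 irr A B h
  · have := indep2 irr A (-B) (by push_cast; exact h)
    simpa using this

theorem indep4 (P Q R S : ℚ) (h : (P : ℝ) + Q * √7 + R * √11 + S * (√7 * √11) = 0) :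
    P = 0 ∧ Q = 0 ∧ R = 0 ∧ S = 0 := by
  have h7 : √7 ^ 2 = (7:ℝ) := Real.sq_sqrt (by norm_num)
  have h11 : √11 ^ 2 = (11:ℝ) := Real.sq_sqrt (by norm_num)
  have e1 := indep2 irr7 (P ^ 2 + 7 * Q ^ 2 - 11 * R ^ 2 - 77 * S ^ 2) (2 * P * Q - 22 * R * S) (by
    push_cast
    linear_combination h * (P + Q * √7 - R * √11 - S * (√7 * √11)) + (-Q ^ 2 + 11 * S ^ 2) * h7 +
      (R ^ 2 + 2 * R * S * √7 + S ^ 2 * √7 ^ 2) * h11)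
  have e2 := indep2 irr11 (P ^ 2 + 11 * R ^ 2 - 7 * Q ^ 2 - 77 * S ^ 2) (2 * P * R - 14 * Q * S) (by
    push_cast
    linear_combination h * (P + R * √11 - Q * √7 - S * (√7 * √11)) + (-R ^ 2 + 7 * S ^ 2) * h11 +
      (Q ^ 2 + 2 * Q * S * √11 + S ^ 2 * √11 ^ 2) * h7)
  have a := sq77 (7 * Q) R (by linarith [e1.1, e2.1])
  have hQ : Q = 0 := by linarith [a.1]
  have hR := a.2
  have b := sq77 P S (by have := e1.1; rw [hQ, hR] at this; linarith)
  exact ⟨b.1, hQ, hR, b.2⟩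

/-- Evaluation of an integer polynomial is compatible with conjugation. -/
theorem poly_conj (p q r s : ℚ) (f : Polynomial ℤ) :
    ∃ P Q R S : ℚ, ∀ u v : ℝ, u ^ 2 = 7 → v ^ 2 = 11 →
      Polynomial.aeval ((p : ℝ) + q * u + r * v + s * (u * v)) f
        = (P : ℝ) + Q * u + R * v + S * (u * v) := by
  induction f using Polynomial.induction_on with
  | C a => exact ⟨a, 0, 0, 0, fun u v _ _ => by simp⟩
  | add f g hf hg =>
    obtain ⟨P, Q, R, S, h⟩ := hf
    obtain ⟨P', Q', R', S', h'⟩ := hg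
    refine ⟨P + P', Q + Q', R + R', S + S', fun u v hu hv => ?_⟩
    rw [map_add, h u v hu hv, h' u v hu hv]; push_cast; ring
  | monomial n a hf =>
    obtain ⟨P, Q, R, S, h⟩ := hf
    refine ⟨P * p + 7 * Q * q + 11 * R * r + 77 * S * s, P * q + Q * p + 11 * R * s + 11 * S * r,
      P * r + R * p + 7 * Q * s + 7 * S * q, P * s + S * p + Q * r + R * q, fun u v hu hv => ?_⟩
    rw [pow_succ, ← mul_assoc (Polynomial.C a), map_mul, h u v hu hv, Polynomial.aeval_X]
    push_cast
    linear_combination (Q * q + (Q * s + S * q) * v + S * s * v ^ 2) * hu +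
      (R * r + (R * s + S * r) * u + 7 * S * s) * hv

theorem conj_integral (p q r s : ℚ)
    (h : IsIntegral ℤ ((p : ℝ) + q * √7 + r * √11 + s * (√7 * √11)))
    (u v : ℝ) (hu : u ^ 2 = 7) (hv : v ^ 2 = 11) :
    IsIntegral ℤ ((p : ℝ) + q * u + r * v + s * (u * v)) := by
  obtain ⟨f, hf, e⟩ := h
  obtain ⟨P, Q, R, S, H⟩ := poly_conj p q r s f
  have h7 : √7 ^ 2 = (7:ℝ) := Real.sq_sqrt (by norm_num)
  have h11 : √11 ^ 2 = (11:ℝ) := Real.sq_sqrt (by norm_num)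
  have e' := H _ _ h7 h11
  rw [Polynomial.aeval_def, e] at e'
  obtain ⟨rfl, rfl, rfl, rfl⟩ := indep4 _ _ _ _ e'.symm
  refine ⟨f, hf, ?_⟩
  have := H u v hu hv
  rw [Polynomial.aeval_def] at this
  rw [this]; simp

theorem field_repr (x : ℝ) (hx : x ∈ biquadField 7 11) :
    ∃ p q r s : ℚ, x = (p : ℝ) + q * √7 + r * √11 + s * (√7 * √11) := by
  have h7 : √7 ^ 2 = (7:ℝ) := Real.sq_sqrt (by norm_num)
  have h11 : √11 ^ 2 = (11:ℝ) := Real.sq_sqrt (by norm_num)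
  have hx' : x ∈ Algebra.adjoin ℚ {√7, √11} := by
    rw [← IntermediateField.adjoin_toSubalgebra_of_isAlgebraic]
    · exact hx
    · intro y hy
      have : IsIntegral ℚ y := by
        apply IsIntegral.of_pow (n := 2) (by norm_num)
        rcases hy with rfl | rfl
        · rw [h7]; exact_mod_cast isIntegral_algebraMap (R := ℚ) (A := ℝ) (x := 7)
        · rw [h11]; exact_mod_cast isIntegral_algebraMap (R := ℚ) (A := ℝ) (x := 11)
      exact this.isAlgebraic
  clear hx
  induction hx' using Algebra.adjoin_induction with
  | mem x hx =>
    rcases hx with rfl | rfl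
    · exact ⟨0, 1, 0, 0, by simp⟩
    · exact ⟨0, 0, 1, 0, by simp⟩
  | algebraMap r => exact ⟨r, 0, 0, 0, by simp⟩
  | add x y hx hy h h' =>
    obtain ⟨p, q, r, s, rfl⟩ := h
    obtain ⟨P, Q, R, S, rfl⟩ := h'
    exact ⟨p + P, q + Q, r + R, s + S, by push_cast; ring⟩
  | mul x y hx hy h h' =>
    obtain ⟨p, q, r, s, rfl⟩ := h
    obtain ⟨P, Q, R, S, rfl⟩ := h'
    refine ⟨P * p + 7 * Q * q + 11 * R * r + 77 * S * s, P * q + Q * p + 11 * R * s + 11 * S * r,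
      P * r + R * p + 7 * Q * s + 7 * S * q, P * s + S * p + Q * r + R * q, ?_⟩
    push_cast
    linear_combination (Q * q + (Q * s + S * q) * √11 + S * s * √11 ^ 2) * h7 +
      (R * r + (R * s + S * r) * √7 + 7 * S * s) * h11

theorem integral_of_eq {x y : ℝ} (h : IsIntegral ℤ x) (e : y = x) : IsIntegral ℤ y := by
  rw [e]; exact h

theorem int_repr (x : ℝ) (hx : x ∈ ringOfInt 7 11) :
    ∃ a b c d : ℤ, 2 * x = (a : ℝ) + b * √7 + c * √11 + d * (√7 * √11) ∧
      2 ∣ a - d ∧ 2 ∣ b - c := by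
  have h7 : √7 ^ 2 = (7:ℝ) := Real.sq_sqrt (by norm_num)
  have h11 : √11 ^ 2 = (11:ℝ) := Real.sq_sqrt (by norm_num)
  obtain ⟨hx, hi⟩ := hx
  obtain ⟨p, q, r, s, rfl⟩ := field_repr x hx
  have i1 := hi
  have i2 := conj_integral p q r s hi (√7) (-√11) h7 (by rw [neg_sq, h11])
  have i3 := conj_integral p q r s hi (-√7) (√11) (by rw [neg_sq, h7]) h11
  have i4 := conj_integral p q r s hi (-√7) (-√11) (by rw [neg_sq, h7]) (by rw [neg_sq, h11])
  have sf7 : Squarefree (7:ℤ) := (show Prime (7:ℤ) by norm_num).squarefree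
  have sf11 : Squarefree (11:ℤ) := (show Prime (11:ℤ) by norm_num).squarefree
  have sf77 : Squarefree (77:ℤ) := by
    rw [← Int.squarefree_natAbs, show Int.natAbs 77 = 7 * 11 by rfl, Nat.squarefree_mul_iff]
    exact ⟨by norm_num, (show Nat.Prime 7 by norm_num).prime.squarefree,
      (show Nat.Prime 11 by norm_num).prime.squarefree⟩
  obtain ⟨T1, W1, ht1, hw1, d1⟩ := quad 7 sf7 (√7) (by rw [h7]; norm_num) (2 * p) (2 * q)
    (by refine integral_of_eq (i1.add i2) ?_; push_cast; ring) (by refine integral_of_eq (i3.add i4) ?_; push_cast; ring)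
  obtain ⟨T2, W2, ht2, hw2, d2⟩ := quad 11 sf11 (√11) (by rw [h11]; norm_num) (2 * p) (2 * r)
    (by refine integral_of_eq (i1.add i3) ?_; push_cast; ring) (by refine integral_of_eq (i2.add i4) ?_; push_cast; ring)
  obtain ⟨T3, W3, ht3, hw3, d3⟩ := quad 77 sf77 (√7 * √11)
    (by rw [mul_pow, h7, h11]; norm_num) (2 * p) (2 * s)
    (by refine integral_of_eq (i1.add i4) ?_; push_cast; ring) (by refine integral_of_eq (i2.add i3) ?_; push_cast; ring)
  have par3 : ∀ m T W : ℤ, m % 4 = 3 → 4 ∣ T ^ 2 - m * W ^ 2 → 2 ∣ T ∧ 2 ∣ W := by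
    intro m T W hm h
    obtain ⟨k, rfl⟩ : ∃ k, m = 4 * k + 3 := ⟨m / 4, by omega⟩
    rcases Int.even_or_odd' T with ⟨t, rfl | rfl⟩ <;> rcases Int.even_or_odd' W with ⟨w, rfl | rfl⟩ <;>
      ring_nf at h <;> omega
  obtain ⟨⟨a, rfl⟩, ⟨b, rfl⟩⟩ := par3 _ _ _ (by norm_num) d1
  obtain ⟨-, ⟨c, rfl⟩⟩ := par3 _ _ _ (by norm_num) d2
  have hT3 : T3 = 2 * a := by
    have : (T3 : ℚ) = ((2 * a : ℤ) : ℚ) := by rw [← ht3, ht1]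
    exact_mod_cast this
  subst hT3
  obtain ⟨d, rfl⟩ : (2:ℤ) ∣ W3 := by
    rcases Int.even_or_odd' W3 with ⟨w, rfl | rfl⟩
    · exact ⟨w, rfl⟩
    · ring_nf at d3; omega
  have ha : p = a / 2 := by push_cast at ht1; linarith
  have hb : q = b / 2 := by push_cast at hw1; linarith
  have hc : r = c / 2 := by push_cast at hw2; linarith
  have hd : s = d / 2 := by push_cast at hw3; linarith
  refine ⟨a, b, c, d, by rw [ha, hb, hc, hd]; push_cast; ring, ?_⟩
  obtain ⟨T4, W4, ht4, hw4, d4⟩ := quad 7 sf7 (√7) (by rw [h7]; norm_num)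
    ((a ^ 2 + 7 * b ^ 2 - 11 * c ^ 2 - 77 * d ^ 2) / 4) ((a * b - 11 * c * d) / 2)
    (by
      refine integral_of_eq (i1.mul i2) ?_; rw [ha, hb, hc, hd]; push_cast
      linear_combination (-(b:ℝ) ^ 2 / 4 + 11 * d ^ 2 / 4) * h7 +
        ((c:ℝ) ^ 2 / 4 + c * d * √7 / 2 + d ^ 2 * √7 ^ 2 / 4) * h11)
    (by
      refine integral_of_eq (i3.mul i4) ?_; rw [ha, hb, hc, hd]; push_cast
      linear_combination (-(b:ℝ) ^ 2 / 4 + 11 * d ^ 2 / 4) * h7 +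
        ((c:ℝ) ^ 2 / 4 - c * d * √7 / 2 + d ^ 2 * √7 ^ 2 / 4) * h11)
  obtain ⟨T5, W5, ht5, hw5, d5⟩ := quad 11 sf11 (√11) (by rw [h11]; norm_num)
    ((a ^ 2 + 11 * c ^ 2 - 7 * b ^ 2 - 77 * d ^ 2) / 4) ((a * c - 7 * b * d) / 2)
    (by
      refine integral_of_eq (i1.mul i3) ?_; rw [ha, hb, hc, hd]; push_cast
      linear_combination (-(c:ℝ) ^ 2 / 4 + 7 * d ^ 2 / 4) * h11 +
        ((b:ℝ) ^ 2 / 4 + b * d * √11 / 2 + d ^ 2 * √11 ^ 2 / 4) * h7)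
    (by
      refine integral_of_eq (i2.mul i4) ?_; rw [ha, hb, hc, hd]; push_cast
      linear_combination (-(c:ℝ) ^ 2 / 4 + 7 * d ^ 2 / 4) * h11 +
        ((b:ℝ) ^ 2 / 4 - b * d * √11 / 2 + d ^ 2 * √11 ^ 2 / 4) * h7)
  obtain ⟨⟨k, rfl⟩, -⟩ := par3 _ _ _ (by norm_num) d4
  obtain ⟨⟨l, rfl⟩, -⟩ := par3 _ _ _ (by norm_num) d5
  have e4 : a ^ 2 + 7 * b ^ 2 - 11 * c ^ 2 - 77 * d ^ 2 = 4 * k := by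
    have : ((a ^ 2 + 7 * b ^ 2 - 11 * c ^ 2 - 77 * d ^ 2 : ℤ) : ℚ) = ((4 * k : ℤ) : ℚ) := by
      push_cast at ht4 ⊢; linarith
    exact_mod_cast this
  have e5 : a ^ 2 + 11 * c ^ 2 - 7 * b ^ 2 - 77 * d ^ 2 = 4 * l := by
    have : ((a ^ 2 + 11 * c ^ 2 - 7 * b ^ 2 - 77 * d ^ 2 : ℤ) : ℚ) = ((4 * l : ℤ) : ℚ) := by
      push_cast at ht5 ⊢; linarith
    exact_mod_cast this
  clear * - e4 e5
  rcases Int.even_or_odd' a with ⟨a, rfl | rfl⟩ <;> rcases Int.even_or_odd' b with ⟨b, rfl | rfl⟩ <;>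
  rcases Int.even_or_odd' c with ⟨c, rfl | rfl⟩ <;> rcases Int.even_or_odd' d with ⟨d, rfl | rfl⟩ <;>
    ring_nf at e4 e5 <;> first | omega | (exfalso; omega)

theorem four_par (p q r s t u v w : ℤ) (h : p ^ 2 + q ^ 2 + r ^ 2 + s ^ 2 = 4)
    (h2 : t ^ 2 + u ^ 2 + v ^ 2 + w ^ 2 = 2) (h1 : p * t + q * u + r * v + s * w = 1) : False := by
  have hs : 2 ∣ t + u + v + w := by
    have e : ∀ z : ℤ, 2 ∣ z ^ 2 - z := fun z => by
      rcases Int.even_or_odd' z with ⟨k, rfl | rfl⟩ <;> ring_nf <;> omega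
    have := e t; have := e u; have := e v; have := e w
    omega
  have hp : (2 ∣ p - q) ∧ (2 ∣ p - r) ∧ (2 ∣ p - s) := by
    rcases Int.even_or_odd' p with ⟨p, rfl | rfl⟩ <;> rcases Int.even_or_odd' q with ⟨q, rfl | rfl⟩ <;>
    rcases Int.even_or_odd' r with ⟨r, rfl | rfl⟩ <;> rcases Int.even_or_odd' s with ⟨s, rfl | rfl⟩ <;>
      ring_nf at h <;> first | omega | (exfalso; omega)
  obtain ⟨⟨x, hx⟩, ⟨y, hy⟩, ⟨z, hz⟩⟩ := hp
  obtain ⟨k, hk⟩ := hs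
  have : (1:ℤ) = 2 * (p * k - x * u - y * v - z * w) := by
    linear_combination -h1 + p * hk - u * hx - v * hy - w * hz
  omega

theorem core0 (A b c : Fin 5 → ℤ) (hbc : ∀ i, 2 ∣ b i - c i)
    (h1 : ∑ i, (4 * A i ^ 2 + 7 * b i ^ 2 + 11 * c i ^ 2) = 96)
    (h2 : ∑ i, A i * b i = 5) (h3 : ∑ i, A i * c i = 1) (h4 : ∑ i, b i * c i = 2) : False := by
  choose y hy using hbc
  have hb : b = fun i => c i + 2 * y i := by funext i; linarith [hy i]
  subst hb
  have csA := Finset.sum_mul_sq_le_sq_mul_sq Finset.univ A (fun i => c i + 2 * y i)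
  have csc := Finset.sum_mul_sq_le_sq_mul_sq Finset.univ A c
  have csy := Finset.sum_mul_sq_le_sq_mul_sq Finset.univ A y
  rw [h2] at csA
  rw [h3] at csc
  have hAy : ∑ i, A i * y i = 2 := by
    have : ∑ i, A i * (c i + 2 * y i) = ∑ i, A i * c i + 2 * ∑ i, A i * y i := by
      rw [Finset.mul_sum, ← Finset.sum_add_distrib]; congr 1; ext; ring
    linarith
  rw [hAy] at csy
  obtain ⟨P, hP⟩ : ∃ P, P = ∑ i, A i ^ 2 := ⟨_, rfl⟩
  obtain ⟨R, hR⟩ : ∃ R, R = ∑ i, c i ^ 2 := ⟨_, rfl⟩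
  obtain ⟨Y, hY⟩ : ∃ Y, Y = ∑ i, y i ^ 2 := ⟨_, rfl⟩
  obtain ⟨Z, hZ⟩ : ∃ Z, Z = ∑ i, c i * y i := ⟨_, rfl⟩
  have hQ : ∑ i, (c i + 2 * y i) ^ 2 = R + 4 * Z + 4 * Y := by
    rw [hR, hZ, hY, Finset.mul_sum, Finset.mul_sum, ← Finset.sum_add_distrib,
      ← Finset.sum_add_distrib]; congr 1; ext; ring
  have hR2 : R + 2 * Z = 2 := by
    refine Eq.trans ?_ h4
    rw [hR, hZ, Finset.mul_sum, ← Finset.sum_add_distrib]; congr 1; ext; ring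
  have h96 : 4 * P + 7 * (R + 4 * Z + 4 * Y) + 11 * R = 96 := by
    rw [← hQ, ← h1, hR, hP, Finset.mul_sum, Finset.mul_sum, Finset.mul_sum, ← Finset.sum_add_distrib,
      ← Finset.sum_add_distrib]
  rw [hQ, ← hP] at csA
  rw [← hP, ← hR] at csc
  rw [← hP, ← hY] at csy
  have P0 : 0 ≤ P := by rw [hP]; positivity
  have R0 : 0 ≤ R := by rw [hR]; positivity
  have Y0 : 0 ≤ Y := by rw [hY]; positivity
  have R1 : 0 < R := by
    rcases R0.lt_or_eq with h | h
    · exact h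
    · rw [← h] at csc; norm_num at csc
  have Y1 : 0 < Y := by
    rcases Y0.lt_or_eq with h | h
    · exact h
    · rw [← h] at csy; norm_num at csy
  have P1 : 0 < P := by
    rcases P0.lt_or_eq with h | h
    · exact h
    · rw [← h] at csy; norm_num at csy
  have hPe : P = 15 - 7 * Y + 2 * Z := by linarith
  have hRe : R = 2 - 2 * Z := by linarith
  have Z0 : Z ≤ 0 := by omega
  have Y2 : Y ≤ 2 := by omega
  have Z3 : -4 ≤ Z := by omega
  have key : Y = 1 ∧ Z = 0 := by
    subst hPe hRe
    clear * - Z0 Y2 Z3 Y1 csA P1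
    interval_cases Y <;> interval_cases Z <;> simp_all
  obtain ⟨rfl, rfl⟩ := key
  have P8 : P = 8 := by omega
  have R2 : R = 2 := by omega
  subst P8 R2
  clear * - hP hR hY hZ hAy h3
  obtain ⟨j, hj⟩ : ∃ j, y j ≠ 0 := by
    by_contra! h
    simp [h] at hY
  have hs : ∀ i, i ≠ j → y i = 0 := by
    intro i hij
    by_contra h
    have h1 : y i ^ 2 + y j ^ 2 ≤ ∑ k, y k ^ 2 := by
      rw [← Finset.sum_pair (f := fun k => y k ^ 2) hij]
      exact Finset.sum_le_sum_of_subset_of_nonneg (Finset.subset_univ _) (fun _ _ _ => sq_nonneg _)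
    have : 0 < y i ^ 2 := by positivity
    have : 0 < y j ^ 2 := by positivity
    omega
  rw [Finset.sum_eq_single j (fun i _ h => by simp [hs i h]) (by simp)] at hY hZ hAy
  have hc : c j = 0 := by
    rcases mul_eq_zero.1 hZ.symm with h | h
    · exact h
    · exact absurd h hj
  have hA : A j ^ 2 = 4 := by
    have : (A j * y j) ^ 2 = 4 := by rw [hAy]; norm_num
    rw [mul_pow, ← hY] at this; linarith
  rw [Fin.sum_univ_succAbove _ j, Fin.sum_univ_four] at hP hR h3
  rw [hc] at hR h3
  rw [hA] at hP
  exact four_par (A (j.succAbove 0)) (A (j.succAbove 1)) (A (j.succAbove 2)) (A (j.succAbove 3))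
    (c (j.succAbove 0)) (c (j.succAbove 1)) (c (j.succAbove 2)) (c (j.succAbove 3)) (by linarith [hP]) (by linarith [hR]) (by linarith [h3])

theorem core (a b c d : Fin 5 → ℤ) (had : ∀ i, 2 ∣ a i - d i) (hbc : ∀ i, 2 ∣ b i - c i)
    (h1 : ∑ i, (a i ^ 2 + 7 * b i ^ 2 + 11 * c i ^ 2 + 77 * d i ^ 2) = 96)
    (h2 : ∑ i, (a i * b i + 11 * (c i * d i)) = 10)
    (h3 : ∑ i, (a i * c i + 7 * (b i * d i)) = 2)
    (h4 : ∑ i, (a i * d i + b i * c i) = 2) : False := by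
  by_cases hd : ∀ i, d i = 0
  · simp only [hd, sub_zero] at *
    choose A hA using had
    have ha : a = fun i => 2 * A i := funext hA
    subst ha
    simp only [mul_zero, add_zero, zero_add, mul_assoc, ← Finset.mul_sum] at h2 h3 h4
    refine core0 A b c hbc ?_ (by linarith) (by linarith) h4
    rw [← h1]; congr 1; ext; ring
  · push Not at hd
    obtain ⟨j, hj⟩ := hd
    have hsq : ∀ z : ℤ, z ≠ 0 → 1 ≤ z ^ 2 := fun z hz => by
      have : 0 < z ^ 2 := by positivity
      omega
    have hdj := hsq _ hj
    have hle : a j ^ 2 + 7 * b j ^ 2 + 11 * c j ^ 2 + 77 * d j ^ 2 ≤ 96 := by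
      rw [← h1]
      exact Finset.single_le_sum
        (f := fun i => a i ^ 2 + 7 * b i ^ 2 + 11 * c i ^ 2 + 77 * d i ^ 2)
        (fun i _ => by positivity) (Finset.mem_univ j)
    have hdj1 : d j = 1 ∨ d j = -1 := by
      have : d j ^ 2 ≤ 1 := by nlinarith [sq_nonneg (a j), sq_nonneg (b j), sq_nonneg (c j)]
      have h1 : d j ≤ 1 := by nlinarith
      have h2 : -1 ≤ d j := by nlinarith
      omega
    have hdj2 : d j ^ 2 = 1 := by rcases hdj1 with h | h <;> rw [h] <;> norm_num
    have haj : 1 ≤ a j ^ 2 := hsq _ (by have := had j; rintro h; omega)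
    have hz : ∀ i, i ≠ j → a i * c i + 7 * (b i * d i) = 0 := by
      intro i hij
      have hp : (a i ^ 2 + 7 * b i ^ 2 + 11 * c i ^ 2 + 77 * d i ^ 2) +
          (a j ^ 2 + 7 * b j ^ 2 + 11 * c j ^ 2 + 77 * d j ^ 2) ≤ 96 := by
        rw [← h1, ← Finset.sum_pair
          (f := fun i => a i ^ 2 + 7 * b i ^ 2 + 11 * c i ^ 2 + 77 * d i ^ 2) hij]
        exact Finset.sum_le_sum_of_subset_of_nonneg (Finset.subset_univ _)
          (fun _ _ _ => by positivity)
      have q1 := sq_nonneg (a i); have q2 := sq_nonneg (b i); have q3 := sq_nonneg (c i)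
      have q4 := sq_nonneg (d i)
      have q5 := sq_nonneg (b j); have q6 := sq_nonneg (c j)
      have hdi : d i = 0 := by
        by_contra h
        have := hsq _ h
        linarith
      rw [hdi]
      by_cases hci : c i = 0
      · rw [hci]; ring
      · have r1 := hsq _ hci
        by_cases hbi : b i = 0
        · exfalso
          obtain ⟨k, hk⟩ := hbc i
          have hk' : c i = 2 * (-k) := by linarith
          rw [hk'] at r1 hp
          have : (1:ℤ) ≤ (-k) ^ 2 := hsq _ (by rintro h; apply hci; rw [hk', h]; rfl)
          have q7 := sq_nonneg (b i)
          nlinarith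
        · have r2 := hsq _ hbi
          have : a i = 0 := by
            by_contra h
            have := hsq _ h
            linarith
          rw [this]; ring
    rw [Finset.sum_eq_single j (fun i _ h => hz i h) (by simp)] at h3
    have q5 := sq_nonneg (b j); have q6 := sq_nonneg (c j)
    have A1 : a j ≤ 4 := by nlinarith
    have A2 : -4 ≤ a j := by nlinarith
    have B1 : b j ≤ 1 := by nlinarith
    have B2 : -1 ≤ b j := by nlinarith
    have C1 : c j ≤ 1 := by nlinarith
    have C2 : -1 ≤ c j := by nlinarith
    have h5 := hbc j
    generalize a j = a at *
    generalize b j = b at *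
    generalize c j = c at *
    generalize d j = d at *
    clear * - A1 A2 B1 B2 C1 C2 h3 hdj1 hle h5
    rcases hdj1 with rfl | rfl <;> interval_cases b <;> interval_cases c <;> omega

theorem no_five (x : Fin 5 → ℝ) (hx : ∀ i, x i ∈ ringOfInt 7 11)
    (h : (1 : ℝ) ^ 2 + 1 ^ 2 + 1 ^ 2 + (2 + Real.sqrt 7) ^ 2
          + ((Real.sqrt 7 + Real.sqrt 11) / 2) ^ 2
          + (1 + (Real.sqrt 7 + Real.sqrt 11) / 2) ^ 2 = ∑ i, x i ^ 2) : False := by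
  have h7 : √7 ^ 2 = (7:ℝ) := Real.sq_sqrt (by norm_num)
  have h11 : √11 ^ 2 = (11:ℝ) := Real.sq_sqrt (by norm_num)
  choose a b c d e had hbc using fun i => int_repr (x i) (hx i)
  have hs : ∀ i, 4 * x i ^ 2 = ((a i ^ 2 + 7 * b i ^ 2 + 11 * c i ^ 2 + 77 * d i ^ 2 : ℤ) : ℝ)
      + 2 * ((a i * b i + 11 * (c i * d i) : ℤ) : ℝ) * √7
      + 2 * ((a i * c i + 7 * (b i * d i) : ℤ) : ℝ) * √11
      + 2 * ((a i * d i + b i * c i : ℤ) : ℝ) * (√7 * √11) := by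
    intro i
    have : 4 * x i ^ 2 = (2 * x i) ^ 2 := by ring
    rw [this, e i]
    push_cast
    linear_combination ((b i:ℝ) ^ 2 + 2 * b i * d i * √11 + d i ^ 2 * √11 ^ 2) * h7 +
      ((c i : ℝ) ^ 2 + 2 * c i * d i * √7 + 7 * d i ^ 2) * h11
  have key : 4 * ∑ i, x i ^ 2 =
      ((∑ i, (a i ^ 2 + 7 * b i ^ 2 + 11 * c i ^ 2 + 77 * d i ^ 2) : ℤ) : ℝ)
      + 2 * ((∑ i, (a i * b i + 11 * (c i * d i)) : ℤ) : ℝ) * √7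
      + 2 * ((∑ i, (a i * c i + 7 * (b i * d i)) : ℤ) : ℝ) * √11
      + 2 * ((∑ i, (a i * d i + b i * c i) : ℤ) : ℝ) * (√7 * √11) := by
    rw [Finset.mul_sum, Finset.sum_congr rfl (fun i _ => hs i)]
    rw [Int.cast_sum, Int.cast_sum, Int.cast_sum, Int.cast_sum]
    simp only [Finset.mul_sum, Finset.sum_mul, ← Finset.sum_add_distrib]
  rw [← h] at key
  obtain ⟨n1, hn1⟩ : ∃ n, n = ∑ i, (a i ^ 2 + 7 * b i ^ 2 + 11 * c i ^ 2 + 77 * d i ^ 2) := ⟨_, rfl⟩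
  obtain ⟨n2, hn2⟩ : ∃ n, n = ∑ i, (a i * b i + 11 * (c i * d i)) := ⟨_, rfl⟩
  obtain ⟨n3, hn3⟩ : ∃ n, n = ∑ i, (a i * c i + 7 * (b i * d i)) := ⟨_, rfl⟩
  obtain ⟨n4, hn4⟩ : ∃ n, n = ∑ i, (a i * d i + b i * c i) := ⟨_, rfl⟩
  rw [← hn1, ← hn2, ← hn3, ← hn4] at key
  obtain ⟨k1, k2, k3, k4⟩ := indep4 (n1 - 96) (2 * n2 - 20) (2 * n3 - 4) (2 * n4 - 4) (by
    push_cast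
    linear_combination -key + 6 * h7 + 2 * h11)
  refine core a b c d had hbc ?_ ?_ ?_ ?_
  · rw [← hn1]; have : (n1:ℚ) = 96 := by linarith
    exact_mod_cast this
  · rw [← hn2]; have : (n2:ℚ) = 10 := by linarith
    exact_mod_cast this
  · rw [← hn3]; have : (n3:ℚ) = 2 := by linarith
    exact_mod_cast this
  · rw [← hn4]; have : (n4:ℚ) = 2 := by linarith
    exact_mod_cast this

theorem k7_11_length_six :
    sqLength (ringOfInt 7 11)
        ((1 : ℝ) ^ 2 + 1 ^ 2 + 1 ^ 2 + (2 + Real.sqrt 7) ^ 2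
          + ((Real.sqrt 7 + Real.sqrt 11) / 2) ^ 2
          + (1 + (Real.sqrt 7 + Real.sqrt 11) / 2) ^ 2) = 6 := by
  have h7 : √7 ^ 2 = (7:ℝ) := Real.sq_sqrt (by norm_num)
  have h11 : √11 ^ 2 = (11:ℝ) := Real.sq_sqrt (by norm_num)
  have m7 : √7 ∈ biquadField 7 11 := IntermediateField.subset_adjoin _ _ (by simp)
  have m11 : √11 ∈ biquadField 7 11 := IntermediateField.subset_adjoin _ _ (by simp)
  have m2 : (2:ℝ) ∈ biquadField 7 11 := by exact_mod_cast (biquadField 7 11).natCast_mem 2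
  have mw : (√7 + √11) / 2 ∈ biquadField 7 11 := div_mem (add_mem m7 m11) m2
  have i7 : IsIntegral ℤ (√7) := by
    apply IsIntegral.of_pow (n := 2) (by norm_num)
    rw [h7]; exact_mod_cast isIntegral_algebraMap (R := ℤ) (A := ℝ) (x := 7)
  have i2 : IsIntegral ℤ (2:ℝ) := by
    exact_mod_cast isIntegral_algebraMap (R := ℤ) (A := ℝ) (x := 2)
  have iw : IsIntegral ℤ ((√7 + √11) / 2) := by
    refine ⟨Polynomial.X ^ 4 - Polynomial.C 9 * Polynomial.X ^ 2 + 1, by monicity!, ?_⟩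
    simp only [Polynomial.eval₂_add, Polynomial.eval₂_sub, Polynomial.eval₂_mul,
      Polynomial.eval₂_pow, Polynomial.eval₂_X, Polynomial.eval₂_C, Polynomial.eval₂_one]
    have e : ((√7 + √11) / 2) ^ 2 = (9 + √7 * √11) / 2 := by
      linear_combination h7 / 4 + h11 / 4
    have e4 : ((√7 + √11) / 2) ^ 4 = ((9 + √7 * √11) / 2) ^ 2 := by rw [← e]; ring
    rw [e4, e]
    simp
    linear_combination √11 ^ 2 / 4 * h7 + 7 / 4 * h11
  have z0 : (0:ℝ) ∈ ringOfInt 7 11 := ⟨zero_mem _, isIntegral_zero⟩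
  have z1 : (1:ℝ) ∈ ringOfInt 7 11 := ⟨one_mem _, isIntegral_one⟩
  have z2 : (2 + √7:ℝ) ∈ ringOfInt 7 11 := ⟨add_mem m2 m7, i2.add i7⟩
  have z3 : (√7 + √11) / 2 ∈ ringOfInt 7 11 := ⟨mw, iw⟩
  have z4 : 1 + (√7 + √11) / 2 ∈ ringOfInt 7 11 := ⟨add_mem (one_mem _) mw, isIntegral_one.add iw⟩
  apply le_antisymm
  · apply sInf_le
    refine ⟨6, by norm_num, ![1, 1, 1, 2 + √7, (√7 + √11) / 2, 1 + (√7 + √11) / 2], ?_, ?_⟩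
    · intro i; fin_cases i
      exacts [z1, z1, z1, z2, z3, z4]
    · rw [Fin.sum_univ_six]; rfl
  · apply le_sInf
    rintro n ⟨k, rfl, hk⟩
    by_contra hlt
    have hk6 : k < 6 := by
      rw [not_le] at hlt
      exact_mod_cast hlt
    have hk5 : k ≤ 5 := by omega
    have : ∀ m, k ≤ m → SumOfSquaresLen (ringOfInt 7 11) m _ := fun m hm =>
      Nat.le_induction hk (fun n _ h => mem_len_succ z0 h) m hm
    obtain ⟨x, hx, e⟩ := this 5 hk5
    exact no_five x hx e
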